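/- Let A be a real m×n matrix, b ∈ ℝ^m, B a real s×n matrix, d ∈ ℝ^s, λ > 0, σ > 0, and fix x ∈ ℝⁿ. Define θ : ℝ^m × ℝ^s → ℝ by θ(u, v) = (1/2)‖u‖² + ⟨b, u⟩ − ⟨d, v⟩ + (1/(2σ))‖S_{σλ}(x − σ(Aᵀu − Bᵀv))‖² − (1/(2σ))‖x‖², where S_{σλ} is the soft-thresholding operator with parameter σλ. Then θ is continuously differentiable on ℝ^m × ℝ^s with gradient ∇θ(u, v) = ( u + b − A·S_{σλ}(x − σ(Aᵀu − Bᵀv)), −d + B·S_{σλ}(x − σ(Aᵀu − Bᵀv)) ). -/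

import Mathlib

open Matrix

/-- Euclidean norm on `Fin n → ℝ`. -/
noncomputable def euclNorm {n : ℕ} (x : Fin n → ℝ) : ℝ := Real.sqrt (∑ i, x i ^ 2)

/-- Euclidean inner product on `Fin n → ℝ`. -/
def dotp {n : ℕ} (x y : Fin n → ℝ) : ℝ := ∑ i, x i * y i

/-- ℓ₁ norm on `Fin n → ℝ`. -/
def l1norm {n : ℕ} (x : Fin n → ℝ) : ℝ := ∑ i, |x i|

/-- Euclidean distance from a point to a set: `inf_{y ∈ S} ‖x − y‖`. -/
noncomputable def distSet {n : ℕ} (x : Fin n → ℝ) (S : Set (Fin n → ℝ)) : ℝ :=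
  sInf ((fun y => euclNorm (x - y)) '' S)

/-- Subdifferential of a (convex) function `g` at `x`. -/
def subdiff {n : ℕ} (g : (Fin n → ℝ) → ℝ) (x : Fin n → ℝ) : Set (Fin n → ℝ) :=
  {s : Fin n → ℝ | ∀ y, g y ≥ g x + dotp s (y - x)}

/-- Soft-thresholding operator with parameter `τ`:
`(S_τ z)ᵢ = sign(zᵢ) · max(|zᵢ| − τ, 0)`; the proximal mapping of `τ‖·‖₁`. -/
noncomputable def softThresh {n : ℕ} (τ : ℝ) (z : Fin n → ℝ) : Fin n → ℝ :=
  fun i => Real.sign (z i) * max (|z i| - τ) 0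

theorem euclNorm_sq {n : ℕ} (x : Fin n → ℝ) : euclNorm x ^ 2 = ∑ i, x i ^ 2 :=
  Real.sq_sqrt (Finset.sum_nonneg fun i _ => sq_nonneg (x i))

theorem dotp_eq_dotProduct {n : ℕ} (x y : Fin n → ℝ) : dotp x y = x ⬝ᵥ y := rfl

theorem hasDerivAt_max_zero_sq (t : ℝ) :
    HasDerivAt (fun r : ℝ => max r 0 ^ 2) (2 * max t 0) t := by
  rw [hasDerivAt_iff_isLittleO]
  refine Asymptotics.IsBigO.trans_isLittleO (g := fun y => (y - t) ^ 2) ?_ ?_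
  · refine Asymptotics.IsBigO.of_bound 1 (Filter.Eventually.of_forall fun y => ?_)
    rw [Real.norm_eq_abs, Real.norm_eq_abs, abs_of_nonneg (sq_nonneg (y - t)), abs_le, smul_eq_mul]
    rcases le_total y 0 with hy | hy <;> rcases le_total t 0 with ht | ht <;>
      simp only [max_eq_left, max_eq_right, hy, ht] <;> constructor <;>
      nlinarith [sq_nonneg (y - t), sq_nonneg y, sq_nonneg t, mul_nonneg (sub_nonneg.2 hy) (sub_nonneg.2 ht)]
  · simpa [Real.norm_eq_abs, sq_abs] using Asymptotics.isLittleO_pow_sub_sub t one_lt_two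

/-- For `0 ≤ τ`, soft thresholding is a difference of two positive parts. -/
theorem sign_mul_max_abs_sub {τ : ℝ} (hτ : 0 ≤ τ) (t : ℝ) :
    Real.sign t * max (|t| - τ) 0 = max (t - τ) 0 - max (-t - τ) 0 := by
  rcases lt_trichotomy t 0 with h | rfl | h
  · rw [Real.sign_of_neg h, abs_of_neg h, max_eq_right (by linarith : t - τ ≤ 0)]
    ring
  · simp
  · rw [Real.sign_of_pos h, abs_of_pos h, max_eq_right (by linarith : -t - τ ≤ 0)]
    ring

theorem sign_mul_max_abs_sub_sq {τ : ℝ} (hτ : 0 ≤ τ) (t : ℝ) :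
    (Real.sign t * max (|t| - τ) 0) ^ 2 = max (t - τ) 0 ^ 2 + max (-t - τ) 0 ^ 2 := by
  rw [sign_mul_max_abs_sub hτ]
  rcases le_total t 0 with h | h
  · rw [max_eq_right (by linarith : t - τ ≤ 0)]
    ring
  · rw [max_eq_right (by linarith : -t - τ ≤ 0)]
    ring

theorem hasDerivAt_sign_mul_max_abs_sub_sq {τ : ℝ} (hτ : 0 ≤ τ) (t : ℝ) :
    HasDerivAt (fun r : ℝ => (Real.sign r * max (|r| - τ) 0) ^ 2)
      (2 * (Real.sign t * max (|t| - τ) 0)) t := by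
  rw [funext (sign_mul_max_abs_sub_sq hτ), sign_mul_max_abs_sub hτ]
  have h₁ := (hasDerivAt_max_zero_sq (t - τ)).comp t ((hasDerivAt_id t).sub_const τ)
  have h₂ := (hasDerivAt_max_zero_sq (-t - τ)).comp t ((hasDerivAt_id t).neg.sub_const τ)
  exact (h₁.add h₂).congr_deriv (by ring)

theorem contDiff_sign_mul_max_abs_sub_sq {τ : ℝ} (hτ : 0 ≤ τ) :
    ContDiff ℝ 1 (fun r : ℝ => (Real.sign r * max (|r| - τ) 0) ^ 2) := by
  rw [contDiff_one_iff_deriv]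
  refine ⟨fun t => (hasDerivAt_sign_mul_max_abs_sub_sq hτ t).differentiableAt, ?_⟩
  rw [funext fun t => (hasDerivAt_sign_mul_max_abs_sub_sq hτ t).deriv]
  simp only [sign_mul_max_abs_sub hτ]
  fun_prop

theorem contDiff_euclNorm_softThresh_sq {n : ℕ} {τ : ℝ} (hτ : 0 ≤ τ) :
    ContDiff ℝ 1 (fun z : Fin n → ℝ => euclNorm (softThresh τ z) ^ 2) := by
  simp only [euclNorm_sq, softThresh]
  exact ContDiff.sum fun i _ => (contDiff_sign_mul_max_abs_sub_sq hτ).comp (contDiff_apply ℝ ℝ i)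

/-- The derivative of `‖S_τ ·‖²` at `z` in direction `w`. -/
theorem hasDerivAt_euclNorm_softThresh_sq_line {n : ℕ} {τ : ℝ} (hτ : 0 ≤ τ) (z w : Fin n → ℝ) :
    HasDerivAt (fun t : ℝ => euclNorm (softThresh τ (z + t • w)) ^ 2)
      (2 * (softThresh τ z ⬝ᵥ w)) 0 := by
  simp only [euclNorm_sq, softThresh, dotProduct, Finset.mul_sum]
  refine HasDerivAt.fun_sum fun i _ => ?_
  have hline : HasDerivAt (fun t : ℝ => (z + t • w) i) (w i) 0 := by
    simpa using ((hasDerivAt_id (0 : ℝ)).mul_const (w i)).const_add (z i)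
  have h := (hasDerivAt_sign_mul_max_abs_sub_sq hτ ((z + (0 : ℝ) • w) i)).comp 0 hline
  refine h.congr_deriv ?_
  simp only [zero_smul, add_zero]
  ring

theorem hasDerivAt_euclNorm_sq_line {n : ℕ} (z w : Fin n → ℝ) :
    HasDerivAt (fun t : ℝ => euclNorm (z + t • w) ^ 2) (2 * (z ⬝ᵥ w)) 0 := by
  simp only [euclNorm_sq, dotProduct, Finset.mul_sum]
  refine HasDerivAt.fun_sum fun i _ => ?_
  have hline : HasDerivAt (fun t : ℝ => (z + t • w) i) (w i) 0 := by
    simpa using ((hasDerivAt_id (0 : ℝ)).mul_const (w i)).const_add (z i)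
  refine (hline.fun_pow 2).congr_deriv ?_
  simp
  ring

theorem hasDerivAt_dotp_line {n : ℕ} (c z w : Fin n → ℝ) :
    HasDerivAt (fun t : ℝ => dotp c (z + t • w)) (c ⬝ᵥ w) 0 := by
  simp only [dotp_eq_dotProduct, dotProduct_add, dotProduct_smul, smul_eq_mul]
  simpa using ((hasDerivAt_id (0 : ℝ)).mul_const (c ⬝ᵥ w)).const_add (c ⬝ᵥ z)

/-- **Smoothness and gradient of the reduced augmented-Lagrangian function `θ`**:
`θ(u,v) = (1/2)‖u‖² + ⟨b,u⟩ − ⟨d,v⟩ + (1/(2σ))‖S_{σλ}(x − σ(Aᵀu − Bᵀv))‖² − (1/(2σ))‖x‖²`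
is continuously differentiable with
`∇θ(u,v) = (u + b − A·S_{σλ}(x − σ(Aᵀu − Bᵀv)), −d + B·S_{σλ}(x − σ(Aᵀu − Bᵀv)))`. -/
theorem theta_contDiff_and_gradient
    {m n s : ℕ} (A : Matrix (Fin m) (Fin n) ℝ) (b : Fin m → ℝ)
    (B : Matrix (Fin s) (Fin n) ℝ) (d : Fin s → ℝ)
    (lam σ : ℝ) (hlam : 0 < lam) (hσ : 0 < σ)
    (x : Fin n → ℝ)
    (θ : (Fin m → ℝ) × (Fin s → ℝ) → ℝ)
    (hθ : θ = fun p =>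
      (1 / 2) * euclNorm p.1 ^ 2 + dotp b p.1 - dotp d p.2
        + (1 / (2 * σ))
            * euclNorm (softThresh (σ * lam) (x - σ • (Aᵀ *ᵥ p.1 - Bᵀ *ᵥ p.2))) ^ 2
        - (1 / (2 * σ)) * euclNorm x ^ 2) :
    ContDiff ℝ 1 θ ∧
    ∀ (u : Fin m → ℝ) (v : Fin s → ℝ),
      ∃ L : ((Fin m → ℝ) × (Fin s → ℝ)) →L[ℝ] ℝ,
        (∀ (du : Fin m → ℝ) (dv : Fin s → ℝ),
          L (du, dv) =
            dotp (u + b - A *ᵥ softThresh (σ * lam) (x - σ • (Aᵀ *ᵥ u - Bᵀ *ᵥ v))) du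
            + dotp (-d + B *ᵥ softThresh (σ * lam) (x - σ • (Aᵀ *ᵥ u - Bᵀ *ᵥ v))) dv) ∧
        HasFDerivAt θ L (u, v) := by
  have hτ : 0 ≤ σ * lam := (mul_pos hσ hlam).le
  have hC : ContDiff ℝ 1 θ := by
    have hA : ContDiff ℝ 1 fun p : (Fin m → ℝ) × (Fin s → ℝ) => Aᵀ *ᵥ p.1 :=
      (Aᵀ.mulVecLin.toContinuousLinearMap).contDiff.comp contDiff_fst
    have hB : ContDiff ℝ 1 fun p : (Fin m → ℝ) × (Fin s → ℝ) => Bᵀ *ᵥ p.2 :=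
      (Bᵀ.mulVecLin.toContinuousLinearMap).contDiff.comp contDiff_snd
    have hS := (contDiff_euclNorm_softThresh_sq (n := n) hτ).comp
      ((contDiff_const (c := x)).sub ((hA.sub hB).const_smul σ))
    have hS' : ContDiff ℝ 1 fun p : (Fin m → ℝ) × (Fin s → ℝ) =>
        euclNorm (softThresh (σ * lam) (x - σ • (Aᵀ *ᵥ p.1 - Bᵀ *ᵥ p.2))) ^ 2 := hS
    have hu : ContDiff ℝ 1 fun p : (Fin m → ℝ) × (Fin s → ℝ) => euclNorm p.1 ^ 2 := by
      simp only [euclNorm_sq]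
      fun_prop
    have hb : ContDiff ℝ 1 fun p : (Fin m → ℝ) × (Fin s → ℝ) => dotp b p.1 := by
      unfold dotp
      fun_prop
    have hd : ContDiff ℝ 1 fun p : (Fin m → ℝ) × (Fin s → ℝ) => dotp d p.2 := by
      unfold dotp
      fun_prop
    rw [hθ]
    fun_prop
  refine ⟨hC, fun u v => ⟨fderiv ℝ θ (u, v), fun du dv => ?_, ?_⟩⟩
  · have hfd := (hC.differentiable one_ne_zero (u, v)).hasFDerivAt.hasLineDerivAt (du, dv)
    refine HasDerivAt.unique hfd ?_
    have harg (t : ℝ) : x - σ • (Aᵀ *ᵥ (u + t • du) - Bᵀ *ᵥ (v + t • dv)) =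
        (x - σ • (Aᵀ *ᵥ u - Bᵀ *ᵥ v)) + t • (-(σ • (Aᵀ *ᵥ du - Bᵀ *ᵥ dv))) := by
      simp only [mulVec_add, mulVec_smul]
      module
    simp only [hθ, Prod.smul_mk, Prod.mk_add_mk, harg]
    set z := x - σ • (Aᵀ *ᵥ u - Bᵀ *ᵥ v)
    refine ((((((hasDerivAt_euclNorm_sq_line u du).const_mul (1 / 2)).add
      (hasDerivAt_dotp_line b u du)).sub (hasDerivAt_dotp_line d v dv)).add
      ((hasDerivAt_euclNorm_softThresh_sq_line hτ z _).const_mul (1 / (2 * σ)))).sub_const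
      _).congr_deriv ?_
    simp only [dotp_eq_dotProduct, sub_dotProduct, add_dotProduct, neg_dotProduct, dotProduct_neg,
      dotProduct_smul, dotProduct_sub, smul_eq_mul, dotProduct_mulVec, vecMul_transpose]
    field_simp
    ring
  · exact (hC.differentiable one_ne_zero (u, v)).hasFDerivAt
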